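/- Let α ≥ β ≥ 0 and 0 ≤ d ≤ β be integers, and set c := β + 1. Then for every integer j ≥ 1: I_j((β+1,d),(α,β)) = −p³ if 1 ≤ j < d; = p² − p³ if j = d; = p² if d + 1 ≤ j < β + 1; = −p^{−1} + 1 − p if j = β + 1 and β + 1 < α + 1; = 1 − p^{−1} if j = β + 1 = α + 1; and = 1 if j > β + 1. (When d = 0 the case j = d does not occur, since j ≥ 1.) -/

import Mathlib

/-- The symbol `[u,v]` of Hironaka, for integers `u ≥ v ≥ 0`. -/
noncomputable def bsym (p u v : ℕ) : ℚ :=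
  (∏ i ∈ Finset.Icc 1 u, (1 - (-(p : ℚ))⁻¹ ^ i)) /
    ((∏ i ∈ Finset.Icc 1 v, (1 - (-(p : ℚ))⁻¹ ^ i)) *
      (∏ i ∈ Finset.Icc 1 (u - v), (1 - (-(p : ℚ))⁻¹ ^ i)))

/-- For a pair `a = (a₁, a₂)`, the quantity `a'_i = #{j ∈ {1,2} : a_j ≥ i}`. -/
def dualCt (a : ℕ × ℕ) (i : ℕ) : ℕ :=
  (if i ≤ a.1 then 1 else 0) + (if i ≤ a.2 then 1 else 0)

/-- Hironaka's local factor `I_j(μ, λ)`, for pairs `μ = (c,d)`, `λ = (λ₁,λ₂)`. -/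
noncomputable def hirI (p : ℕ) (μ lam : ℕ × ℕ) (j : ℕ) : ℚ :=
  ∑ i ∈ Finset.Icc (dualCt μ (j + 1))
      (min (dualCt (lam.1 + 1, lam.2 + 1) (j + 1)) (dualCt μ j)),
    (-(p : ℚ)) ^ (i * (2 * dualCt (lam.1 + 1, lam.2 + 1) (j + 1) + 1 - i) / 2) *
      bsym p (dualCt (lam.1 + 1, lam.2 + 1) (j + 1) - dualCt μ (j + 1))
        (dualCt (lam.1 + 1, lam.2 + 1) (j + 1) - i) *
      bsym p (dualCt (lam.1 + 1, lam.2 + 1) j - i)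
        (dualCt (lam.1 + 1, lam.2 + 1) j - dualCt μ j)

theorem hirI_eq_of_dualCt {p : ℕ} {μ lam : ℕ × ℕ} {j a b c e : ℕ}
    (ha : dualCt μ j = a) (hb : dualCt μ (j + 1) = b)
    (hc : dualCt (lam.1 + 1, lam.2 + 1) j = c)
    (he : dualCt (lam.1 + 1, lam.2 + 1) (j + 1) = e) :
    hirI p μ lam j = ∑ i ∈ Finset.Icc b (min e a),
      (-(p : ℚ)) ^ (i * (2 * e + 1 - i) / 2) * bsym p (e - b) (e - i) * bsym p (c - i) (c - a) := by
  subst ha hb hc he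
  rfl

theorem one_sub_neg_inv_pow_ne_zero {p : ℕ} (hp : 2 ≤ p) {i : ℕ} (hi : i ≠ 0) :
    1 - (-(p : ℚ))⁻¹ ^ i ≠ 0 := by
  have hp' : (1 : ℚ) < p := by exact_mod_cast hp
  have h : |(-(p : ℚ))⁻¹ ^ i| < 1 := by
    rw [abs_pow, abs_inv, abs_neg, abs_of_pos (by linarith)]
    exact pow_lt_one₀ (by positivity) (inv_lt_one_of_one_lt₀ hp') hi
  have := (abs_lt.mp h).2
  linarith

theorem prod_one_sub_neg_inv_pow_ne_zero {p : ℕ} (hp : 2 ≤ p) (u : ℕ) :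
    ∏ i ∈ Finset.Icc 1 u, (1 - (-(p : ℚ))⁻¹ ^ i) ≠ 0 :=
  Finset.prod_ne_zero_iff.mpr fun _ hi =>
    one_sub_neg_inv_pow_ne_zero hp (Nat.one_le_iff_ne_zero.mp (Finset.mem_Icc.mp hi).1)

theorem bsym_self {p : ℕ} (hp : 2 ≤ p) (u : ℕ) : bsym p u u = 1 := by
  simp [bsym, -inv_neg, -inv_pow, div_self (prod_one_sub_neg_inv_pow_ne_zero hp u)]

theorem bsym_zero_right {p : ℕ} (hp : 2 ≤ p) (u : ℕ) : bsym p u 0 = 1 := by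
  simp [bsym, -inv_neg, -inv_pow, div_self (prod_one_sub_neg_inv_pow_ne_zero hp u)]

theorem bsym_two_one {p : ℕ} (hp : 2 ≤ p) : bsym p 2 1 = 1 - (p : ℚ)⁻¹ := by
  have h : 1 + (p : ℚ)⁻¹ ≠ 0 := by positivity
  have h2 : Finset.Icc 1 2 = {1, 2} := by decide
  simp only [bsym, h2, Nat.reduceSub, Finset.Icc_self, Finset.prod_singleton,
    Finset.mem_singleton, OfNat.one_ne_ofNat, not_false_eq_true, Finset.prod_insert, inv_neg,
    pow_one, sub_neg_eq_add]
  field_simp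
  ring

theorem statement10 (p : ℕ) (hp : p.Prime) (hodd : Odd p)
    (α β d : ℕ) (hβα : β ≤ α) (hdβ : d ≤ β)
    (j : ℕ) (hj : 1 ≤ j) :
    (j < d → hirI p (β + 1, d) (α, β) j = -(p : ℚ) ^ 3) ∧
    (j = d → hirI p (β + 1, d) (α, β) j = (p : ℚ) ^ 2 - (p : ℚ) ^ 3) ∧
    (d + 1 ≤ j ∧ j < β + 1 → hirI p (β + 1, d) (α, β) j = (p : ℚ) ^ 2) ∧
    (j = β + 1 ∧ β + 1 < α + 1 →
      hirI p (β + 1, d) (α, β) j = -(p : ℚ)⁻¹ + 1 - (p : ℚ)) ∧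
    (j = β + 1 ∧ β + 1 = α + 1 → hirI p (β + 1, d) (α, β) j = 1 - (p : ℚ)⁻¹) ∧
    (β + 1 < j → hirI p (β + 1, d) (α, β) j = 1) := by
  have hp2 := hp.two_le
  have h01 : Finset.Icc 0 1 = {0, 1} := by decide
  have h12 : Finset.Icc 1 2 = {1, 2} := by decide
  have key (a b c e : ℕ) (ha : dualCt (β + 1, d) j = a) (hb : dualCt (β + 1, d) (j + 1) = b)
      (hc : dualCt (α + 1, β + 1) j = c) (he : dualCt (α + 1, β + 1) (j + 1) = e) :=
    hirI_eq_of_dualCt (p := p) (μ := (β + 1, d)) (lam := (α, β)) ha hb hc he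
  refine ⟨fun h => ?_, fun h => ?_, fun h => ?_, fun h => ?_, fun h => ?_, fun h => ?_⟩
  · rw [key 2 2 2 2] <;> try grind [dualCt]
    simp [bsym_self hp2, Odd.neg_pow (by decide : Odd 3)]
  · rw [key 2 1 2 2] <;> try grind [dualCt]
    simp [h12, bsym_self hp2, bsym_zero_right hp2]
    ring
  · rw [key 1 1 2 2] <;> try grind [dualCt]
    simp [bsym_self hp2]
  · rw [key 1 0 2 1] <;> try grind [dualCt]
    simp [h01, bsym_self hp2, bsym_zero_right hp2, bsym_two_one hp2]
    ring
  · rw [key 1 0 2 0] <;> try grind [dualCt]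
    simp [bsym_self hp2, bsym_two_one hp2]
  · rw [key 0 0 _ _ (by grind [dualCt]) (by grind [dualCt]) rfl rfl]
    simp [bsym_self hp2]
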